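/- arXiv:2009.02022 — 8 statements merged into one kernel-verified Lean document; each statement's English description precedes it below -/
import Mathlib

section
/- Let G be the group defined by the presentation with generator a, y and the single relator y a y^{-1} a. Since the relator has even total exponent in y, there is a well-defined group homomorphism φ : G → ℤ/2ℤ determined by φ(a) = 0 and φ(y) = 1. Then the kernel of φ is generated by a and y^2, these two elements commute in G, and the kernel is a free abelian group of rank 2 (isomorphic to ℤ × ℤ). -/
/-- The Klein bottle group `G = ⟨a, y ∣ y a y⁻¹ a⟩`, presented with generator type `Bool`,
where `a` corresponds to `false` and `y` to `true`. -/
def kleinBottleRels : Set (FreeGroup Bool) :=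
  {FreeGroup.of true * FreeGroup.of false * (FreeGroup.of true)⁻¹ * FreeGroup.of false}

namespace KleinAux

abbrev G := PresentedGroup kleinBottleRels
def a : G := PresentedGroup.of false
def y : G := PresentedGroup.of true

lemma rel : y * a * y⁻¹ * a = 1 := by
  have h : PresentedGroup.mk kleinBottleRels
      (FreeGroup.of true * FreeGroup.of false * (FreeGroup.of true)⁻¹ * FreeGroup.of false) = 1 :=
    PresentedGroup.one_of_mem (by simp [kleinBottleRels])
  rw [map_mul, map_mul, map_mul, map_inv] at h
  exact h

lemma semi : SemiconjBy y a a⁻¹ := by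
  have h := rel
  unfold SemiconjBy
  rw [mul_eq_one_iff_eq_inv] at h
  rw [← h]; group

lemma semi' : SemiconjBy y⁻¹ a a⁻¹ := by
  have h := semi.inv_right
  rw [inv_inv] at h
  exact SemiconjBy.inv_symm_left h

lemma comm2 : Commute (y ^ 2) a := by
  have h := semi.inv_right
  rw [inv_inv] at h
  have := h.mul_left semi
  rw [← pow_two] at this
  exact this

lemma nf (g : G) : ∃ i j : ℤ, g = a ^ i * y ^ j := by
  have hg : g ∈ Subgroup.closure (Set.range (PresentedGroup.of (rels := kleinBottleRels))) := by
    rw [PresentedGroup.closure_range_of]; trivial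
  induction hg using Subgroup.closure_induction_left with
  | one => exact ⟨0, 0, by simp⟩
  | mul_left x hx z hz ih =>
    obtain ⟨i, j, rfl⟩ := ih
    obtain ⟨b, rfl⟩ := hx
    cases b
    · refine ⟨1 + i, j, ?_⟩
      rw [zpow_one_add, mul_assoc]; rfl
    · refine ⟨-i, 1 + j, ?_⟩
      have h := (semi.zpow_right i).eq
      rw [zpow_one_add, ← mul_assoc, ← mul_assoc, zpow_neg, ← inv_zpow, ← h]; rfl
  | inv_mul_cancel x hx z hz ih =>
    obtain ⟨i, j, rfl⟩ := ih
    obtain ⟨b, rfl⟩ := hx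
    cases b
    · refine ⟨-1 + i, j, ?_⟩
      rw [zpow_add, mul_assoc, zpow_neg_one]; rfl
    · refine ⟨-i, -1 + j, ?_⟩
      have h := (semi'.zpow_right i).eq
      rw [zpow_add, zpow_neg_one, ← mul_assoc, ← mul_assoc, zpow_neg, ← inv_zpow, ← h]; rfl

def pa : Equiv.Perm (ℤ × ℤ) where
  toFun p := (p.1 + 1, p.2)
  invFun p := (p.1 - 1, p.2)
  left_inv p := by simp
  right_inv p := by simp

def py : Equiv.Perm (ℤ × ℤ) where
  toFun p := (-p.1, p.2 + 1)
  invFun p := (-p.1, p.2 - 1)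
  left_inv p := by simp
  right_inv p := by simp

def rho : G →* Equiv.Perm (ℤ × ℤ) :=
  PresentedGroup.toGroup (f := fun b => bif b then py else pa) (by
    intro r hr
    rw [kleinBottleRels, Set.mem_singleton_iff] at hr
    subst hr
    simp only [map_mul, map_inv, FreeGroup.lift_apply_of, cond_true, cond_false]
    ext p <;> simp [Equiv.Perm.mul_apply, pa, py, Equiv.Perm.inv_def])

lemma rho_a : rho a = pa := PresentedGroup.toGroup.of _
lemma rho_y : rho y = py := PresentedGroup.toGroup.of _

lemma pa_zpow (i : ℤ) (p : ℤ × ℤ) : (pa ^ i) p = (p.1 + i, p.2) := by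
  induction i generalizing p with
  | zero => simp
  | succ n ih => rw [zpow_add_one, Equiv.Perm.mul_apply, ih]; simp [pa]; ring
  | pred n ih =>
    rw [zpow_sub_one, Equiv.Perm.mul_apply, ih]; simp [pa, Equiv.Perm.inv_def]; ring

lemma py_zpow (i : ℤ) (p : ℤ × ℤ) : ((py ^ 2) ^ i) p = (p.1, p.2 + 2 * i) := by
  induction i generalizing p with
  | zero => simp
  | succ n ih => rw [zpow_add_one, Equiv.Perm.mul_apply, ih]; simp [py, pow_two]; ring
  | pred n ih =>
    rw [zpow_sub_one, Equiv.Perm.mul_apply, ih]; simp [py, Equiv.Perm.inv_def, pow_two]; ring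

lemma rho_nf (i j : ℤ) : rho (a ^ i * (y ^ 2) ^ j) (0, 0) = (i, 2 * j) := by
  rw [map_mul, map_zpow, map_zpow, map_pow, rho_a, rho_y, Equiv.Perm.mul_apply, py_zpow, pa_zpow]
  simp

def phi : G →* Multiplicative (ZMod 2) :=
  PresentedGroup.toGroup (f := fun b => bif b then Multiplicative.ofAdd 1 else 1) (by
    intro r hr
    rw [kleinBottleRels, Set.mem_singleton_iff] at hr
    subst hr
    simp)

lemma phi_a : phi a = 1 := PresentedGroup.toGroup.of _
lemma phi_y : phi y = Multiplicative.ofAdd 1 := PresentedGroup.toGroup.of _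

lemma ker_nf (g : G) : g ∈ phi.ker ↔ ∃ i j : ℤ, g = a ^ i * (y ^ 2) ^ j := by
  rw [MonoidHom.mem_ker]
  constructor
  · intro h
    obtain ⟨i, j, rfl⟩ := nf g
    rw [map_mul, map_zpow, map_zpow, phi_a, phi_y, one_zpow, one_mul, ← ofAdd_zsmul,
      ofAdd_eq_one, zsmul_one, ZMod.intCast_zmod_eq_zero_iff_dvd] at h
    obtain ⟨k, rfl⟩ := h
    exact ⟨i, k, by rw [zpow_mul]; rfl⟩
  · rintro ⟨i, j, rfl⟩
    have h2 : (Multiplicative.ofAdd (1 : ZMod 2)) ^ 2 = 1 := by decide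
    rw [map_mul, map_zpow, map_zpow, map_pow, phi_a, phi_y, h2]; simp

lemma ker_eq : phi.ker = Subgroup.closure {a, y ^ 2} := by
  apply le_antisymm
  · intro g hg
    obtain ⟨i, j, rfl⟩ := (ker_nf g).1 hg
    exact mul_mem (zpow_mem (Subgroup.subset_closure (by simp)) _)
      (zpow_mem (Subgroup.subset_closure (by simp)) _)
  · rw [Subgroup.closure_le]
    rintro g (rfl | rfl)
    · exact (ker_nf _).2 ⟨1, 0, by simp⟩
    · exact (ker_nf _).2 ⟨0, 1, by simp⟩

def toKer : Multiplicative (ℤ × ℤ) →* phi.ker :=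
  MonoidHom.mk' (fun p => ⟨a ^ p.toAdd.1 * (y ^ 2) ^ p.toAdd.2, (ker_nf _).2 ⟨_, _, rfl⟩⟩) (by
    intro p q
    apply Subtype.ext
    have h := (comm2.zpow_zpow p.toAdd.2 q.toAdd.1).eq
    simp only [toAdd_mul, Prod.fst_add, Prod.snd_add, zpow_add, Subgroup.coe_mul]
    rw [mul_assoc, mul_assoc, ← mul_assoc (a ^ q.toAdd.1), ← h, mul_assoc])

lemma toKer_bij : Function.Bijective toKer := by
  constructor
  · intro p q h
    have h1 : a ^ p.toAdd.1 * (y ^ 2) ^ p.toAdd.2 = a ^ q.toAdd.1 * (y ^ 2) ^ q.toAdd.2 :=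
      congrArg Subtype.val h
    have h2 := congrArg (fun g => rho g (0, 0)) h1
    simp only [rho_nf, Prod.mk.injEq] at h2
    apply Multiplicative.toAdd.injective
    exact Prod.ext h2.1 (by omega)
  · rintro ⟨g, hg⟩
    obtain ⟨i, j, rfl⟩ := (ker_nf g).1 hg
    exact ⟨Multiplicative.ofAdd (i, j), rfl⟩

end KleinAux

/-- There is a homomorphism `φ : G → ℤ/2ℤ` with `φ(a) = 0`, `φ(y) = 1`; its kernel is the
subgroup generated by `a` and `y²`, these two elements commute in `G`, and the kernel is a
free abelian group of rank `2`, i.e. isomorphic to `ℤ × ℤ`. -/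
theorem twist_subgroup_N21 :
    ∃ φ : PresentedGroup kleinBottleRels →* Multiplicative (ZMod 2),
      φ (PresentedGroup.of false) = 1 ∧
      φ (PresentedGroup.of true) = Multiplicative.ofAdd 1 ∧
      φ.ker = Subgroup.closure
        {PresentedGroup.of false, (PresentedGroup.of true) ^ 2} ∧
      (PresentedGroup.of false * (PresentedGroup.of true : PresentedGroup kleinBottleRels) ^ 2
        = (PresentedGroup.of true) ^ 2 * PresentedGroup.of false) ∧
      Nonempty (φ.ker ≃* Multiplicative (ℤ × ℤ)) := by
  exact ⟨KleinAux.phi, KleinAux.phi_a, KleinAux.phi_y, KleinAux.ker_eq, KleinAux.comm2.eq.symm,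
    ⟨(MulEquiv.ofBijective KleinAux.toKer KleinAux.toKer_bij).symm⟩⟩
end

section
/- Let G be the group defined by the presentation with generators a1, a2, y and relators a1 a2 a1 a2^{-1} a1^{-1} a2^{-1}, (a1 a2)^6, y^2, (a1 y)^2, (a2 y)^2. Since every relator has even total exponent in y, there is a well-defined group homomorphism φ : G → ℤ/2ℤ determined by φ(a1) = φ(a2) = 0 and φ(y) = 1. Then the kernel of φ is isomorphic to the presented group ⟨x1, x2 ∣ x1 x2 x1 x2^{-1} x1^{-1} x2^{-1}, (x1 x2)^6⟩, via an isomorphism sending x1 to a1 and x2 to a2. -/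
/-- The group `ℳ(N₃,₀) = ⟨a₁, a₂, y ∣ a₁a₂a₁a₂⁻¹a₁⁻¹a₂⁻¹, (a₁a₂)⁶, y², (a₁y)², (a₂y)²⟩`,
presented with generator type `Fin 3`, where `a₁, a₂, y` correspond to `0, 1, 2`. -/
def mcgN30Rels : Set (FreeGroup (Fin 3)) :=
  {FreeGroup.of 0 * FreeGroup.of 1 * FreeGroup.of 0 * (FreeGroup.of 1)⁻¹ *
      (FreeGroup.of 0)⁻¹ * (FreeGroup.of 1)⁻¹,
    (FreeGroup.of 0 * FreeGroup.of 1) ^ 6,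
    FreeGroup.of 2 ^ 2,
    (FreeGroup.of 0 * FreeGroup.of 2) ^ 2,
    (FreeGroup.of 1 * FreeGroup.of 2) ^ 2}

/-- The group `⟨x₁, x₂ ∣ x₁x₂x₁x₂⁻¹x₁⁻¹x₂⁻¹, (x₁x₂)⁶⟩`, presented with generator
type `Fin 2`, where `x₁, x₂` correspond to `0, 1`. -/
def twistN30Rels : Set (FreeGroup (Fin 2)) :=
  {FreeGroup.of 0 * FreeGroup.of 1 * FreeGroup.of 0 * (FreeGroup.of 1)⁻¹ *
      (FreeGroup.of 0)⁻¹ * (FreeGroup.of 1)⁻¹,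
    (FreeGroup.of 0 * FreeGroup.of 1) ^ 6}

abbrev TG := PresentedGroup twistN30Rels
abbrev MG := PresentedGroup mcgN30Rels

def twistLift {H : Type*} [Group H] (a b : H) (h1 : a * b * a = b * a * b)
    (h2 : (a * b) ^ 6 = 1) : TG →* H :=
  PresentedGroup.toGroup (f := ![a, b]) (by
    intro r hr
    rcases hr with rfl | rfl
    · simp [h1, mul_assoc]
      simp only [← mul_assoc, h1]; group
    · simpa using h2)

theorem twistLift_zero {H : Type*} [Group H] (a b : H) (h1 : a * b * a = b * a * b)
    (h2 : (a * b) ^ 6 = 1) : twistLift a b h1 h2 (PresentedGroup.of 0) = a := by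
  simp [twistLift]

theorem twistLift_one {H : Type*} [Group H] (a b : H) (h1 : a * b * a = b * a * b)
    (h2 : (a * b) ^ 6 = 1) : twistLift a b h1 h2 (PresentedGroup.of 1) = b := by
  simp [twistLift]

def mcgLift {H : Type*} [Group H] (a b y : H) (h1 : a * b * a = b * a * b)
    (h2 : (a * b) ^ 6 = 1) (h3 : y ^ 2 = 1) (h4 : (a * y) ^ 2 = 1) (h5 : (b * y) ^ 2 = 1) :
    MG →* H :=
  PresentedGroup.toGroup (f := ![a, b, y]) (by
    intro r hr
    rcases hr with rfl | rfl | rfl | rfl | rfl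
    · simp
      simp only [h1]; group
    · simpa using h2
    · simpa using h3
    · simpa using h4
    · simpa using h5)

theorem TG_braid : (PresentedGroup.of 0 * PresentedGroup.of 1 * PresentedGroup.of 0 : TG) =
    PresentedGroup.of 1 * PresentedGroup.of 0 * PresentedGroup.of 1 := by
  have h : _ = (1 : TG) := PresentedGroup.one_of_mem (rels := twistN30Rels) (Or.inl rfl)
  simp only [map_mul, map_inv] at h
  change (PresentedGroup.of 0 * PresentedGroup.of 1 * PresentedGroup.of 0 *
    (PresentedGroup.of 1)⁻¹ * (PresentedGroup.of 0)⁻¹ * (PresentedGroup.of 1)⁻¹ : TG) = 1 at h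
  rw [mul_inv_eq_one, mul_inv_eq_iff_eq_mul, mul_inv_eq_iff_eq_mul] at h
  exact h

theorem TG_six : (PresentedGroup.of 0 * PresentedGroup.of 1 : TG) ^ 6 = 1 :=
  PresentedGroup.one_of_mem (rels := twistN30Rels) (Or.inr rfl)

theorem MG_braid : (PresentedGroup.of 0 * PresentedGroup.of 1 * PresentedGroup.of 0 : MG) =
    PresentedGroup.of 1 * PresentedGroup.of 0 * PresentedGroup.of 1 := by
  have h : _ = (1 : MG) := PresentedGroup.one_of_mem (rels := mcgN30Rels) (Or.inl rfl)
  simp only [map_mul, map_inv] at h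
  change (PresentedGroup.of 0 * PresentedGroup.of 1 * PresentedGroup.of 0 *
    (PresentedGroup.of 1)⁻¹ * (PresentedGroup.of 0)⁻¹ * (PresentedGroup.of 1)⁻¹ : MG) = 1 at h
  rw [mul_inv_eq_one, mul_inv_eq_iff_eq_mul, mul_inv_eq_iff_eq_mul] at h
  exact h

theorem MG_six : (PresentedGroup.of 0 * PresentedGroup.of 1 : MG) ^ 6 = 1 :=
  PresentedGroup.one_of_mem (rels := mcgN30Rels) (Or.inr (Or.inl rfl))

theorem MG_y : (PresentedGroup.of 2 : MG) ^ 2 = 1 :=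
  PresentedGroup.one_of_mem (rels := mcgN30Rels) (Or.inr (Or.inr (Or.inl rfl)))

theorem MG_ay : (PresentedGroup.of 0 * PresentedGroup.of 2 : MG) ^ 2 = 1 :=
  PresentedGroup.one_of_mem (rels := mcgN30Rels) (Or.inr (Or.inr (Or.inr (Or.inl rfl))))

theorem MG_by : (PresentedGroup.of 1 * PresentedGroup.of 2 : MG) ^ 2 = 1 :=
  PresentedGroup.one_of_mem (rels := mcgN30Rels) (Or.inr (Or.inr (Or.inr (Or.inr rfl))))

def sig : TG →* TG :=
  twistLift (PresentedGroup.of 0)⁻¹ (PresentedGroup.of 1)⁻¹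
    (by
      have := congrArg (·⁻¹) TG_braid
      simpa [mul_assoc] using this)
    (by
      rw [← mul_inv_rev, inv_pow, inv_eq_one]
      have h : (PresentedGroup.of 1 * PresentedGroup.of 0 : TG) =
        (PresentedGroup.of 0)⁻¹ * (PresentedGroup.of 0 * PresentedGroup.of 1) *
          ((PresentedGroup.of 0)⁻¹)⁻¹ := by group
      rw [h, conj_pow, TG_six]; simp)

theorem sig_zero : sig (PresentedGroup.of 0) = (PresentedGroup.of 0)⁻¹ := twistLift_zero ..
theorem sig_one : sig (PresentedGroup.of 1) = (PresentedGroup.of 1)⁻¹ := twistLift_one ..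

theorem sig_sig : sig.comp sig = MonoidHom.id TG := by
  apply PresentedGroup.ext
  intro i
  fin_cases i
  · simp [sig_zero]
  · simp [sig_one]

def sigA : MulAut TG := MonoidHom.toMulEquiv sig sig sig_sig sig_sig

theorem sigA_apply (t : TG) : sigA t = sig t := rfl

theorem sigA_sq : sigA ^ 2 = 1 := by
  rw [pow_two]
  ext t
  exact DFunLike.congr_fun sig_sig t

def jj : TG →* MG := twistLift (PresentedGroup.of 0) (PresentedGroup.of 1) MG_braid MG_six

theorem jj_zero : jj (PresentedGroup.of 0) = PresentedGroup.of 0 := twistLift_zero ..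
theorem jj_one : jj (PresentedGroup.of 1) = PresentedGroup.of 1 := twistLift_one ..

open SemidirectProduct in
def hol : MG →* TG ⋊[MonoidHom.id (MulAut TG)] MulAut TG :=
  mcgLift (inl (PresentedGroup.of 0)) (inl (PresentedGroup.of 1)) (inr sigA)
    (by simp only [← map_mul]; rw [TG_braid])
    (by simp only [← map_mul, ← map_pow]; rw [TG_six]; simp)
    (by rw [← map_pow, sigA_sq, map_one])
    (by
      have := sigA_sq
      rw [pow_two] at this
      rw [pow_two]
      ext1
      · simp [sigA_apply, sig_zero]
      · simp [this])
    (by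
      have := sigA_sq
      rw [pow_two] at this
      rw [pow_two]
      ext1
      · simp [sigA_apply, sig_one]
      · simp [this])

theorem hol_jj : hol.comp jj = SemidirectProduct.inl := by
  apply PresentedGroup.ext
  intro i
  fin_cases i
  · simp [jj_zero, hol, mcgLift]
  · simp [jj_one, hol, mcgLift]

theorem jj_inj : Function.Injective jj := by
  intro s t h
  have h2 := congrArg hol h
  rw [← MonoidHom.comp_apply, ← MonoidHom.comp_apply, hol_jj] at h2
  exact SemidirectProduct.inl_injective h2

theorem yy : (PresentedGroup.of 2 * PresentedGroup.of 2 : MG) = 1 := by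
  rw [← pow_two]; exact MG_y

theorem y_conj (t : TG) : (PresentedGroup.of 2 : MG) * jj t = jj (sig t) * PresentedGroup.of 2 := by
  have h : (MulAut.conj (PresentedGroup.of 2 : MG)).toMonoidHom.comp jj = jj.comp sig := by
    have aux (a y : MG) (hy : y * y = 1) (h : (a * y) ^ 2 = 1) : y * a * y⁻¹ = a⁻¹ := by
      have hy' : y⁻¹ = y := inv_eq_of_mul_eq_one_left hy
      rw [hy']
      apply eq_inv_of_mul_eq_one_right
      rw [← h, pow_two]; simp only [mul_assoc]
    apply PresentedGroup.ext
    intro i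
    fin_cases i
    · simpa [jj_zero, sig_zero] using aux _ _ yy MG_ay
    · simpa [jj_one, sig_one] using aux _ _ yy MG_by
  have := DFunLike.congr_fun h t
  simp at this
  rw [← this]; group

theorem cosets (g : MG) : ∃ t, g = jj t ∨ g = jj t * PresentedGroup.of 2 := by
  let H : Subgroup MG :=
    { carrier := {g | ∃ t, g = jj t ∨ g = jj t * PresentedGroup.of 2}
      one_mem' := ⟨1, Or.inl (map_one _).symm⟩
      mul_mem' := by
        rintro _ _ ⟨s, rfl | rfl⟩ ⟨t, rfl | rfl⟩
        · exact ⟨s * t, Or.inl (map_mul ..).symm⟩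
        · exact ⟨s * t, Or.inr (by rw [map_mul, mul_assoc])⟩
        · exact ⟨s * sig t, Or.inr (by rw [map_mul, mul_assoc, y_conj, mul_assoc])⟩
        · refine ⟨s * sig t, Or.inl ?_⟩
          rw [map_mul, mul_assoc, ← mul_assoc _ (jj t), y_conj, mul_assoc, yy, mul_one]
      inv_mem' := by
        rintro _ ⟨s, rfl | rfl⟩
        · exact ⟨s⁻¹, Or.inl (map_inv ..).symm⟩
        · refine ⟨sig s⁻¹, Or.inr ?_⟩
          rw [← y_conj, mul_inv_rev, map_inv, inv_eq_of_mul_eq_one_left yy] }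
  refine PresentedGroup.generated_by _ H ?_ g
  intro i
  fin_cases i
  · exact ⟨PresentedGroup.of 0, Or.inl jj_zero.symm⟩
  · exact ⟨PresentedGroup.of 1, Or.inl jj_one.symm⟩
  · exact ⟨1, Or.inr (by simp)⟩

def phi : MG →* Multiplicative (ZMod 2) :=
  mcgLift 1 1 (Multiplicative.ofAdd 1) (by simp) (by simp) (by decide) (by decide) (by decide)

theorem phi_jj (t : TG) : phi (jj t) = 1 := by
  have h : phi.comp jj = 1 := by
    apply PresentedGroup.ext
    intro i
    fin_cases i
    · simp [jj_zero, phi, mcgLift]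
    · simp [jj_one, phi, mcgLift]
  exact DFunLike.congr_fun h t

theorem phi_y : phi (PresentedGroup.of 2) = Multiplicative.ofAdd 1 := by
  simp [phi, mcgLift]

/-- There is a homomorphism `φ : ℳ(N₃,₀) → ℤ/2ℤ` with `φ(a₁) = φ(a₂) = 0`, `φ(y) = 1`,
whose kernel is isomorphic to `⟨x₁, x₂ ∣ x₁x₂x₁x₂⁻¹x₁⁻¹x₂⁻¹, (x₁x₂)⁶⟩` via an
isomorphism sending `x₁ ↦ a₁` and `x₂ ↦ a₂`. -/
theorem twist_subgroup_N30 :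
    ∃ φ : PresentedGroup mcgN30Rels →* Multiplicative (ZMod 2),
      φ (PresentedGroup.of 0) = 1 ∧
      φ (PresentedGroup.of 1) = 1 ∧
      φ (PresentedGroup.of 2) = Multiplicative.ofAdd 1 ∧
      ∃ ψ : PresentedGroup twistN30Rels ≃* φ.ker,
        ((ψ (PresentedGroup.of 0) : φ.ker) : PresentedGroup mcgN30Rels)
            = PresentedGroup.of 0 ∧
        ((ψ (PresentedGroup.of 1) : φ.ker) : PresentedGroup mcgN30Rels)
            = PresentedGroup.of 1 := by
  refine ⟨phi, by simp [phi, mcgLift], by simp [phi, mcgLift], phi_y, ?_⟩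
  refine ⟨MulEquiv.ofBijective (jj.codRestrict phi.ker phi_jj) ⟨?_, ?_⟩, jj_zero, jj_one⟩
  · intro s t h
    exact jj_inj (congrArg Subtype.val h)
  · rintro ⟨g, hg⟩
    obtain ⟨t, rfl | rfl⟩ := cosets g
    · exact ⟨t, rfl⟩
    · exfalso
      rw [MonoidHom.mem_ker, map_mul, phi_jj, phi_y] at hg
      revert hg
      decide
end

section
/- Let G be a group and let a1, a2, e, f ∈ G satisfy the braid relations a1 a2 a1 = a2 a1 a2, a1 e a1 = e a1 e, a1 f a1 = f a1 f, and the commutation relations e a2 = a2 e, f a2 = a2 f. Then (a2 e a1)^2 (a2 f a1)^2 = a2 a1 e a1 a2 a1 a2 a1 a2 f a1 a2 holds in G. -/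
/-- Rewriting of Stukow's relation (B̅2₁): under the braid relations
`a₁a₂a₁ = a₂a₁a₂`, `a₁ea₁ = ea₁e`, `a₁fa₁ = fa₁f` and the commutation relations
`ea₂ = a₂e`, `fa₂ = a₂f`, one has
`(a₂ea₁)²(a₂fa₁)² = a₂a₁ea₁a₂a₁a₂a₁a₂fa₁a₂`. -/
theorem relation_B2_1_rewrite {G : Type*} [Group G] (a₁ a₂ e f : G)
    (hb : a₁ * a₂ * a₁ = a₂ * a₁ * a₂)
    (he : a₁ * e * a₁ = e * a₁ * e)
    (hf : a₁ * f * a₁ = f * a₁ * f)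
    (h₁ : e * a₂ = a₂ * e) (h₂ : f * a₂ = a₂ * f) :
    (a₂ * e * a₁) ^ 2 * (a₂ * f * a₁) ^ 2 =
      a₂ * a₁ * e * a₁ * a₂ * a₁ * a₂ * a₁ * a₂ * f * a₁ * a₂ := by
  have k1 : (a₂ * e * a₁) ^ 2 = a₂ * a₁ * e * a₁ * a₂ * a₁ := by
    calc (a₂ * e * a₁) ^ 2 = a₂ * (e * (a₁ * ((a₂ * e) * a₁))) := by simp only [pow_two, mul_assoc]
      _ = a₂ * (e * a₁ * e) * a₂ * a₁ := by rw [← h₁]; simp only [mul_assoc]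
      _ = _ := by rw [← he]; simp only [mul_assoc]
  have k2 : (a₂ * f * a₁) ^ 2 = a₂ * a₁ * a₂ * f * a₁ * a₂ := by
    calc (a₂ * f * a₁) ^ 2 = a₂ * (f * (a₁ * ((a₂ * f) * a₁))) := by simp only [pow_two, mul_assoc]
      _ = a₂ * (f * a₁ * f) * a₂ * a₁ := by rw [← h₂]; simp only [mul_assoc]
      _ = a₂ * a₁ * f * (a₁ * a₂ * a₁) := by rw [← hf]; simp only [mul_assoc]
      _ = a₂ * a₁ * (f * a₂) * a₁ * a₂ := by rw [hb]; simp only [mul_assoc]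
      _ = _ := by rw [h₂]; simp only [mul_assoc]
  rw [k1, k2]
  simp only [mul_assoc]
end

section
/- Let G be a group and let a1, a2, e, f ∈ G satisfy the braid relations a1 a2 a1 = a2 a1 a2, a1 e a1 = e a1 e, a1 f a1 = f a1 f, and the commutation relations e a2 = a2 e, f a2 = a2 f. Then (a2 a1 e a1 a2 a1 a2 a1 a2 f a1 a2)(a2 a1 f a1 a2 a1 a2 a1 a2 e a1 a2) = (a2 e a1)^2 (a2 f a1)^4 (a2 e a1)^2 holds in G. -/
theorem braid_sq_left {G : Type*} [Group G] (a b e : G)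
    (hb : a * b * a = b * a * b) (he : a * e * a = e * a * e) (h : e * b = b * e) :
    (b * e * a) ^ 2 = b * a * e * a * b * a := by
  calc (b * e * a) ^ 2 = b * (e * a) * (b * e) * a := by simp only [pow_two, mul_assoc]
    _ = b * (e * a * e) * b * a := by rw [h.symm]; simp only [mul_assoc]
    _ = _ := by rw [← he]; simp only [mul_assoc]

theorem braid_sq_right {G : Type*} [Group G] (a b e : G)
    (hb : a * b * a = b * a * b) (he : a * e * a = e * a * e) (h : e * b = b * e) :
    (b * e * a) ^ 2 = b * a * b * e * a * b := by
  rw [braid_sq_left a b e hb he h]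
  calc b * a * e * a * b * a = b * a * e * (a * b * a) := by simp only [mul_assoc]
    _ = b * a * (e * b) * a * b := by rw [hb]; simp only [mul_assoc]
    _ = _ := by rw [h]; simp only [mul_assoc]

/-- Rewriting of Stukow's relation (B̅2₂): under the braid relations
`a₁a₂a₁ = a₂a₁a₂`, `a₁ea₁ = ea₁e`, `a₁fa₁ = fa₁f` and the commutation relations
`ea₂ = a₂e`, `fa₂ = a₂f`, one has
`(a₂a₁ea₁a₂a₁a₂a₁a₂fa₁a₂)(a₂a₁fa₁a₂a₁a₂a₁a₂ea₁a₂) = (a₂ea₁)²(a₂fa₁)⁴(a₂ea₁)²`. -/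
theorem relation_B2_2_rewrite {G : Type*} [Group G] (a₁ a₂ e f : G)
    (hb : a₁ * a₂ * a₁ = a₂ * a₁ * a₂)
    (he : a₁ * e * a₁ = e * a₁ * e)
    (hf : a₁ * f * a₁ = f * a₁ * f)
    (h₁ : e * a₂ = a₂ * e) (h₂ : f * a₂ = a₂ * f) :
    (a₂ * a₁ * e * a₁ * a₂ * a₁ * a₂ * a₁ * a₂ * f * a₁ * a₂) *
      (a₂ * a₁ * f * a₁ * a₂ * a₁ * a₂ * a₁ * a₂ * e * a₁ * a₂) =
    (a₂ * e * a₁) ^ 2 * (a₂ * f * a₁) ^ 4 * (a₂ * e * a₁) ^ 2 := by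
  have e4 : (a₂ * f * a₁) ^ 4 = (a₂ * f * a₁) ^ 2 * (a₂ * f * a₁) ^ 2 := by
    rw [← pow_add]
  have l1 := braid_sq_left a₁ a₂ e hb he h₁
  have r1 := braid_sq_right a₁ a₂ e hb he h₁
  have l2 := braid_sq_left a₁ a₂ f hb hf h₂
  have r2 := braid_sq_right a₁ a₂ f hb hf h₂
  calc _ = (a₂ * a₁ * e * a₁ * a₂ * a₁) *
        ((a₂ * a₁ * a₂ * f * a₁ * a₂) * (a₂ * a₁ * f * a₁ * a₂ * a₁)) *
        (a₂ * a₁ * a₂ * e * a₁ * a₂) := by simp only [mul_assoc]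
    _ = (a₂ * e * a₁) ^ 2 * ((a₂ * f * a₁) ^ 2 * (a₂ * f * a₁) ^ 2) * (a₂ * e * a₁) ^ 2 := by
        rw [← r2]
        nth_rewrite 1 [← l1]
        rw [← r1, ← l2]
    _ = _ := by rw [e4]
end

section
/- Let G be a group and let x1, …, xm ∈ G (m ≥ 2) satisfy the braid relations: xi xj = xj xi whenever |i − j| ≥ 2, and xi x(i+1) xi = x(i+1) xi x(i+1) for 1 ≤ i ≤ m−1. Then (x1 x2 ⋯ xm)^{m+1} = (x1 x2 ⋯ xm)(xm x(m−1) ⋯ x2 x1) · (x2 x3 ⋯ xm)^m. -/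
theorem aux_down {G : Type*} [Group G] (y : ℕ → G) (k : ℕ) :
    ((List.range (k + 1)).map fun i => y (k + 1 - i)).prod
      = y (k + 1) * ((List.range k).map fun i => y (k - i)).prod := by
  rw [List.range_succ_eq_map, List.map_cons, List.prod_cons, List.map_map]
  congr 3
  funext i
  simp

theorem aux_down' {G : Type*} [Group G] (x : ℕ → G) (k : ℕ) :
    ((List.range (k + 1)).map fun i => x (k + 1 - i)).prod
      = ((List.range k).map fun i => x (k - i + 1)).prod * x 1 := by
  induction k with
  | zero => simp
  | succ k ih =>
    rw [aux_down x (k + 1), ih, aux_down (fun j => x (j + 1)) k, mul_assoc]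

theorem aux_up {G : Type*} [Group G] (y : ℕ → G) (k : ℕ) :
    ((List.range (k + 1)).map fun i => y i).prod
      = ((List.range k).map fun i => y i).prod * y k := by
  simp [List.range_succ]

theorem aux_comm {G : Type*} [Group G] (m : ℕ) (x : ℕ → G)
    (hcomm : ∀ i j, 1 ≤ i → 1 ≤ j → i ≤ m → j ≤ m → i + 2 ≤ j → x i * x j = x j * x i)
    (n j : ℕ) (h : n + 2 ≤ j) (hj : j ≤ m) :
    ((List.range n).map fun i => x (i + 1)).prod * x j
      = x j * ((List.range n).map fun i => x (i + 1)).prod := by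
  induction n with
  | zero => simp
  | succ n ih =>
    rw [aux_up (fun i => x (i + 1)), mul_assoc,
      hcomm (n + 1) j (by omega) (by omega) (by omega) hj (by omega),
      ← mul_assoc, ih (by omega), mul_assoc]

theorem aux_shift {G : Type*} [Group G] (m : ℕ) (x : ℕ → G)
    (hcomm : ∀ i j, 1 ≤ i → 1 ≤ j → i ≤ m → j ≤ m → i + 2 ≤ j → x i * x j = x j * x i)
    (hbraid : ∀ i, 1 ≤ i → i ≤ m - 1 → x i * x (i + 1) * x i = x (i + 1) * x i * x (i + 1))
    (i n : ℕ) (hi : i + 2 ≤ n) (hn : n ≤ m) :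
    ((List.range n).map fun i => x (i + 1)).prod * x (i + 1)
      = x (i + 2) * ((List.range n).map fun i => x (i + 1)).prod := by
  induction n, hi using Nat.le_induction with
  | base =>
    have hb := hbraid (i + 1) (by omega) (by omega)
    have hc := aux_comm m x hcomm i (i + 2) le_rfl hn
    rw [aux_up (fun i => x (i + 1)), aux_up (fun i => x (i + 1))]
    simp only [mul_assoc] at hb hc ⊢
    rw [hb, ← mul_assoc, hc, mul_assoc]
  | succ n hi ih =>
    rw [aux_up (fun i => x (i + 1)), mul_assoc,
      ← hcomm (i + 1) (n + 1) (by omega) (by omega) (by omega) hn (by omega),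
      ← mul_assoc, ih (by omega), mul_assoc]

theorem aux_move {G : Type*} [Group G] (m : ℕ) (x : ℕ → G) (A : G)
    (hA : ∀ i, i + 2 ≤ m → A * x (i + 1) = x (i + 2) * A) (k : ℕ) (hk : k + 1 ≤ m) :
    A * ((List.range k).map fun i => x (k - i)).prod
      = ((List.range k).map fun i => x (k - i + 1)).prod * A := by
  induction k with
  | zero => simp
  | succ k ih =>
    rw [aux_down x k, aux_down (fun j => x (j + 1)) k, ← mul_assoc, hA k (by omega),
      mul_assoc, ih (by omega), mul_assoc]

/-- If `x₁, …, xₘ` satisfy the braid relations, then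
`(x₁x₂⋯xₘ)^(m+1) = (x₁x₂⋯xₘ)(xₘx₍ₘ₋₁₎⋯x₂x₁) · (x₂x₃⋯xₘ)^m`. -/
theorem braid_power_factorization {G : Type*} [Group G] (m : ℕ) (hm : 2 ≤ m) (x : ℕ → G)
    (hcomm : ∀ i j, 1 ≤ i → 1 ≤ j → i ≤ m → j ≤ m → i + 2 ≤ j → x i * x j = x j * x i)
    (hbraid : ∀ i, 1 ≤ i → i ≤ m - 1 → x i * x (i + 1) * x i = x (i + 1) * x i * x (i + 1)) :
    (((List.range m).map fun i => x (i + 1)).prod) ^ (m + 1) =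
      (((List.range m).map fun i => x (i + 1)).prod) *
        (((List.range m).map fun i => x (m - i)).prod) *
        (((List.range (m - 1)).map fun i => x (i + 2)).prod) ^ m := by
  obtain ⟨n, rfl⟩ : ∃ n, m = n + 1 := ⟨m - 1, by omega⟩
  have hA := fun i hi => aux_shift (n + 1) x hcomm hbraid i (n + 1) hi le_rfl
  have hAB : ((List.range (n + 1)).map fun i => x (i + 1)).prod
      = x 1 * ((List.range (n + 1 - 1)).map fun i => x (i + 2)).prod := by
    rw [List.range_succ_eq_map, List.map_cons, List.prod_cons, List.map_map]
    rfl
  generalize ((List.range (n + 1)).map fun i => x (i + 1)).prod = A at *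
  generalize ((List.range (n + 1 - 1)).map fun i => x (i + 2)).prod = B at *
  have key : ∀ k, k ≤ n + 1 →
      A ^ k = ((List.range k).map fun i => x (k - i)).prod * B ^ k := by
    intro k
    induction k with
    | zero => simp
    | succ k ih =>
      intro hk
      rw [pow_succ', ih (by omega), ← mul_assoc, aux_move (n + 1) x A hA k hk, aux_down' x k,
        hAB, pow_succ']
      simp only [mul_assoc]
  rw [pow_succ', key (n + 1) le_rfl, mul_assoc]
end

section
/- Let G be a group and let x1, …, xm ∈ G (m ≥ 2) satisfy the braid relations: xi xj = xj xi whenever |i − j| ≥ 2, and xi x(i+1) xi = x(i+1) xi x(i+1) for 1 ≤ i ≤ m−1. Then the element (x1 x2 ⋯ xm)(xm x(m−1) ⋯ x2 x1) commutes with xj for every j with 2 ≤ j ≤ m. -/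
theorem braid_aux {G : Type*} [Group G] (m : ℕ) (x P Q : ℕ → G)
    (hcomm : ∀ i j, 1 ≤ i → 1 ≤ j → i ≤ m → j ≤ m → i + 2 ≤ j → x i * x j = x j * x i)
    (hbraid : ∀ i, 1 ≤ i → i ≤ m - 1 → x i * x (i + 1) * x i = x (i + 1) * x i * x (i + 1))
    (P0 : P 0 = 1) (Q0 : Q 0 = 1)
    (hP : ∀ k, P (k + 1) = P k * x (k + 1)) (hQ : ∀ k, Q (k + 1) = x (k + 1) * Q k)
    (i : ℕ) (hi : 1 ≤ i) (k : ℕ) (hik : i + 1 ≤ k) (hk : k ≤ m) :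
    P k * x i = x (i + 1) * P k ∧ Q k * x (i + 1) = x i * Q k := by
  have hc : ∀ k j, k + 2 ≤ j → j ≤ m → P k * x j = x j * P k ∧ Q k * x j = x j * Q k := by
    intro k
    induction k with
    | zero => intro j _ _; simp [P0, Q0]
    | succ k ih =>
      intro j h1 h2
      obtain ⟨a, b⟩ := ih j (by omega) h2
      have c := hcomm (k + 1) j (by omega) (by omega) (by omega) h2 (by omega)
      rw [hP, hQ]
      constructor
      · rw [mul_assoc, c, ← mul_assoc, a, mul_assoc]
      · rw [mul_assoc, b, ← mul_assoc, c, mul_assoc]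
  induction k, hik using Nat.le_induction with
  | base =>
    obtain ⟨n, rfl⟩ : ∃ n, i = n + 1 := ⟨i - 1, by omega⟩
    obtain ⟨a, b⟩ := hc n (n + 1 + 1) (by omega) hk
    have c := hbraid (n + 1) hi (by omega)
    rw [hP, hQ, hP, hQ]
    constructor
    · calc _ = P n * (x (n + 1) * x (n + 1 + 1) * x (n + 1)) := by group
        _ = (P n * x (n + 1 + 1)) * x (n + 1) * x (n + 1 + 1) := by rw [c]; group
        _ = _ := by rw [a]; group
    · calc _ = x (n + 1 + 1) * x (n + 1) * (Q n * x (n + 1 + 1)) := by group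
        _ = (x (n + 1 + 1) * x (n + 1) * x (n + 1 + 1)) * Q n := by rw [b]; group
        _ = _ := by rw [← c]; group
  | succ k hik ih =>
    obtain ⟨a, b⟩ := ih (by omega)
    have c := hcomm i (k + 1) hi (by omega) (by omega) hk (by omega)
    rw [hP, hQ]
    constructor
    · rw [mul_assoc, ← c, ← mul_assoc, a, mul_assoc]
    · rw [mul_assoc, b, ← mul_assoc, ← c, mul_assoc]

/-- If `x₁, …, xₘ` satisfy the braid relations, then `(x₁x₂⋯xₘ)(xₘx₍ₘ₋₁₎⋯x₂x₁)`
commutes with `xⱼ` for every `2 ≤ j ≤ m`. -/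
theorem braid_pure_element_commutes {G : Type*} [Group G] (m : ℕ) (hm : 2 ≤ m) (x : ℕ → G)
    (hcomm : ∀ i j, 1 ≤ i → 1 ≤ j → i ≤ m → j ≤ m → i + 2 ≤ j → x i * x j = x j * x i)
    (hbraid : ∀ i, 1 ≤ i → i ≤ m - 1 → x i * x (i + 1) * x i = x (i + 1) * x i * x (i + 1))
    (j : ℕ) (hj1 : 2 ≤ j) (hj2 : j ≤ m) :
    (((List.range m).map fun i => x (i + 1)).prod *
        ((List.range m).map fun i => x (m - i)).prod) * x j =
      x j * (((List.range m).map fun i => x (i + 1)).prod *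
        ((List.range m).map fun i => x (m - i)).prod) := by
  obtain ⟨i, rfl⟩ : ∃ i, j = i + 1 := ⟨j - 1, by omega⟩
  obtain ⟨a, b⟩ := braid_aux m x (fun k => ((List.range k).map fun i => x (i + 1)).prod)
    (fun k => ((List.range k).map fun i => x (k - i)).prod) hcomm hbraid (by simp) (by simp)
    (fun k => by simp [List.range_succ])
    (fun k => by simp [List.range_succ_eq_map, Function.comp_def])
    i (by omega) m hj2 le_rfl
  rw [mul_assoc, b, ← mul_assoc, a, mul_assoc]
end

section
/- Let G be a group and let x1, …, xm ∈ G (m ≥ 2) satisfy the braid relations: xi xj = xj xi whenever |i − j| ≥ 2, and xi x(i+1) xi = x(i+1) xi x(i+1) for 1 ≤ i ≤ m−1. Then (x1 x2 ⋯ xm)^{2(m+1)} = (x2 x3 ⋯ xm)^{2m} · ((x1 x2 ⋯ xm)(xm x(m−1) ⋯ x2 x1))^2. -/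
namespace BraidAux

def P {G : Type*} [Group G] (x : ℕ → G) (n : ℕ) : G := ((List.range n).map fun i => x (i + 1)).prod

theorem P_succ {G : Type*} [Group G] (x : ℕ → G) (n : ℕ) : P x (n+1) = P x n * x (n+1) := by
  simp [P, List.prod_range_succ]

def R {G : Type*} [Group G] (x : ℕ → G) (n k : ℕ) : G := ((List.range k).map fun i => x (n - i)).prod

theorem R_succ {G : Type*} [Group G] (x : ℕ → G) (n k : ℕ) : R x n (k+1) = R x n k * x (n - k) := by
  simp [R, List.prod_range_succ]

theorem R_succ' {G : Type*} [Group G] (x : ℕ → G) (n k : ℕ) :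
    R x (n+1) (k+1) = x (n+1) * R x n k := by
  simp [R, List.prod_range_succ']

theorem R_inv {G : Type*} [Group G] (x : ℕ → G) (n : ℕ) :
    (R x n n)⁻¹ = P (fun i => (x i)⁻¹) n := by
  induction n with
  | zero => simp [R, P]
  | succ n ih => rw [R_succ', P_succ, mul_inv_rev, ih]

theorem P_comm {G : Type*} [Group G] (m : ℕ) (x : ℕ → G)
    (hcomm : ∀ i j, 1 ≤ i → 1 ≤ j → i ≤ m → j ≤ m → i + 2 ≤ j → x i * x j = x j * x i)
    (k j : ℕ) (h : k + 2 ≤ j) (hj : j ≤ m) : P x k * x j = x j * P x k := by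
  induction k with
  | zero => simp [P]
  | succ k ih =>
    rw [P_succ, mul_assoc, hcomm (k+1) j (by omega) (by omega) (by omega) hj (by omega),
      ← mul_assoc, ih (by omega), mul_assoc]

theorem shift {G : Type*} [Group G] (m : ℕ) (x : ℕ → G)
    (hcomm : ∀ i j, 1 ≤ i → 1 ≤ j → i ≤ m → j ≤ m → i + 2 ≤ j → x i * x j = x j * x i)
    (hbraid : ∀ i, 1 ≤ i → i ≤ m - 1 → x i * x (i + 1) * x i = x (i + 1) * x i * x (i + 1))
    (n i : ℕ) (hn : n ≤ m) (hi : 1 ≤ i) (hin : i + 1 ≤ n) :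
    P x n * x i = x (i+1) * P x n := by
  induction n with
  | zero => omega
  | succ n ih =>
    rcases Nat.lt_or_ge i n with h | h
    · rw [P_succ, mul_assoc, ← hcomm i (n+1) hi (by omega) (by omega) hn (by omega),
        ← mul_assoc, ih (by omega) (by omega), mul_assoc]
    · obtain ⟨k, rfl⟩ : ∃ k, n = k + 1 := ⟨n - 1, by omega⟩
      obtain rfl : i = k + 1 := by omega
      have hb := hbraid (k+1) (by omega) (by omega)
      have hc := P_comm m x hcomm k (k+1+1) (by omega) hn
      rw [P_succ, P_succ]
      calc _ = P x k * (x (k+1) * x (k+1+1) * x (k+1)) := by group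
        _ = (P x k * x (k+1+1)) * x (k+1) * x (k+1+1) := by rw [hb]; group
        _ = _ := by rw [hc]; group

end BraidAux


/-- If `x₁, …, xₘ` satisfy the braid relations, then
`(x₁x₂⋯xₘ)^(2(m+1)) = (x₂x₃⋯xₘ)^(2m) · ((x₁x₂⋯xₘ)(xₘx₍ₘ₋₁₎⋯x₂x₁))²`. -/
theorem braid_even_power_factorization {G : Type*} [Group G] (m : ℕ) (hm : 2 ≤ m) (x : ℕ → G)
    (hcomm : ∀ i j, 1 ≤ i → 1 ≤ j → i ≤ m → j ≤ m → i + 2 ≤ j → x i * x j = x j * x i)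
    (hbraid : ∀ i, 1 ≤ i → i ≤ m - 1 → x i * x (i + 1) * x i = x (i + 1) * x i * x (i + 1)) :
    (((List.range m).map fun i => x (i + 1)).prod) ^ (2 * (m + 1)) =
      (((List.range (m - 1)).map fun i => x (i + 2)).prod) ^ (2 * m) *
        (((List.range m).map fun i => x (i + 1)).prod *
          ((List.range m).map fun i => x (m - i)).prod) ^ 2 := by
  obtain ⟨n, rfl⟩ : ∃ n, m = n + 1 := ⟨m - 1, by omega⟩
  have hs := BraidAux.shift (n+1) x hcomm hbraid (n+1)
  have hs' := BraidAux.shift (n+1) (fun i => (x i)⁻¹)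
    (fun i j a b c d e => by
      have := hcomm i j a b c d e
      simp only [← mul_inv_rev, this])
    (fun i a b => by
      have := hbraid i a b
      simp only [← mul_inv_rev, ← mul_assoc, this]) (n+1)
  rw [← BraidAux.R_inv] at hs'
  have hr : ∀ i, 1 ≤ i → i ≤ n → BraidAux.R x (n+1) (n+1) * x (i+1)
      = x i * BraidAux.R x (n+1) (n+1) := by
    intro i h1 h2
    have := congrArg (·⁻¹) (hs' i le_rfl h1 (by omega))
    simp only [mul_inv_rev, inv_inv] at this
    exact this.symm
  change BraidAux.P x (n+1) ^ _ = (((List.range n).map fun i => x (i + 2)).prod) ^ _ *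
    (BraidAux.P x (n+1) * BraidAux.R x (n+1) (n+1)) ^ 2
  have hA : ∀ k, k ≤ n → Commute (((List.range k).map fun i => x (i + 2)).prod)
      (BraidAux.P x (n+1) * BraidAux.R x (n+1) (n+1)) := by
    intro k hk
    induction k with
    | zero => simp
    | succ k ih =>
      rw [List.prod_range_succ]
      refine (ih (by omega)).mul_left ?_
      change _ * _ = _ * _
      rw [mul_assoc (BraidAux.P x (n+1)), hr (k+1) (by omega) (by omega), ← mul_assoc, ← mul_assoc, hs (k+1) le_rfl (by omega) (by omega)]
  have hE : ∀ k, k ≤ n → SemiconjBy (BraidAux.P x (n+1)) (BraidAux.P x k)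
      (((List.range k).map fun i => x (i + 2)).prod) := by
    intro k hk
    induction k with
    | zero => simp [BraidAux.P]
    | succ k ih =>
      rw [List.prod_range_succ, BraidAux.P_succ x k]
      exact (ih (by omega)).mul_right (hs (k+1) le_rfl (by omega) (by omega))
  have hT : ∀ k, k ≤ n → SemiconjBy (BraidAux.P x (n+1)) (BraidAux.R x n k)
      (BraidAux.R x (n+1) k) := by
    intro k hk
    induction k with
    | zero => simp [BraidAux.R]
    | succ k ih =>
      rw [BraidAux.R_succ, BraidAux.R_succ]
      refine (ih (by omega)).mul_right ?_
      have := hs (n-k) le_rfl (by omega) (by omega)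
      rwa [show n - k + 1 = n + 1 - k by omega] at this
  have hP : ∀ k, k ≤ n + 1 → BraidAux.P x (n+1) ^ k = BraidAux.P x n ^ k * BraidAux.R x (n+1) k := by
    intro k hk
    induction k with
    | zero => simp [BraidAux.R]
    | succ k ih =>
      rw [pow_succ, ih (by omega), mul_assoc, ← (hT k (by omega)).eq, BraidAux.R_succ', pow_succ]
      rw [BraidAux.P_succ]
      simp only [mul_assoc]
  have key : BraidAux.P x (n+1) ^ (n+1+1) = (((List.range n).map fun i => x (i + 2)).prod) ^ (n+1) *
    (BraidAux.P x (n+1) * BraidAux.R x (n+1) (n+1)) := by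
    rw [pow_succ', hP _ le_rfl, ← mul_assoc, ((hE n le_rfl).pow_right (n+1)).eq, mul_assoc]
  rw [mul_comm 2, pow_mul, key, ((hA n le_rfl).pow_left (n+1)).mul_pow, ← pow_mul, mul_comm 2]
end

section
/- Let N ≥ 3 be an odd integer, let G be a group, and let r, e, a2, a3, …, aN ∈ G satisfy: (i) r ai = ai r for all 3 ≤ i ≤ N; (ii) r a2 = e^{-1} r; (iii) a2 r = r e^{-1}; (iv) r^2 = 1; and (v) r = (a2 a3 ⋯ aN · e^{-1} a3 ⋯ aN)^{(N−1)/2} · a2 a3 ⋯ aN. Then (r · a2 a3 ⋯ aN)^N = 1. -/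
/-- Derivation of Stukow's relation (C̅4): if `N ≥ 3` is odd and `r, e, a₂, …, a_N` satisfy
(i) `r aᵢ = aᵢ r` for `3 ≤ i ≤ N`, (ii) `r a₂ = e⁻¹ r`, (iii) `a₂ r = r e⁻¹`,
(iv) `r² = 1`, and (v) `r = (a₂a₃⋯a_N · e⁻¹a₃⋯a_N)^((N−1)/2) · a₂a₃⋯a_N`,
then `(r · a₂a₃⋯a_N)^N = 1`. -/
theorem relation_C4 {G : Type*} [Group G] (N : ℕ) (hN : 3 ≤ N) (hodd : Odd N)
    (r e : G) (a : ℕ → G)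
    (h1 : ∀ i, 3 ≤ i → i ≤ N → r * a i = a i * r)
    (h2 : r * a 2 = e⁻¹ * r)
    (h3 : a 2 * r = r * e⁻¹)
    (h4 : r ^ 2 = 1)
    (h5 : r = ((((List.range (N - 1)).map fun i => a (i + 2)).prod * e⁻¹ *
        ((List.range (N - 2)).map fun i => a (i + 3)).prod) ^ ((N - 1) / 2)) *
        ((List.range (N - 1)).map fun i => a (i + 2)).prod) :
    (r * ((List.range (N - 1)).map fun i => a (i + 2)).prod) ^ N = 1 := by
  obtain ⟨k, rfl⟩ := hodd
  obtain ⟨m, rfl⟩ : ∃ m, k = m + 1 := ⟨k - 1, by omega⟩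
  have e1 : 2 * (m + 1) + 1 - 1 = (2 * m + 1) + 1 := by omega
  have e2 : 2 * (m + 1) + 1 - 2 = 2 * m + 1 := by omega
  have e3 : (2 * m + 1 + 1) / 2 = m + 1 := by omega
  rw [e1, e2, e3] at h5
  rw [e1]
  have hA : ((List.range (2 * m + 1 + 1)).map fun i => a (i + 2)).prod
      = a 2 * ((List.range (2 * m + 1)).map fun i => a (i + 3)).prod := by
    rw [List.range_succ_eq_map, List.map_cons, List.prod_cons, List.map_map]
    rfl
  have hB : Commute r ((List.range (2 * m + 1)).map fun i => a (i + 3)).prod := by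
    apply Commute.list_prod_right
    intro x hx
    rw [List.mem_map] at hx
    obtain ⟨i, hi, rfl⟩ := hx
    rw [List.mem_range] at hi
    exact h1 _ (by omega) (by omega)
  generalize ((List.range (2 * m + 1)).map fun i => a (i + 3)).prod = B at *
  generalize ((List.range (2 * m + 1 + 1)).map fun i => a (i + 2)).prod = A at *
  have hr : r * r = 1 := by rw [← pow_two, h4]
  have he : A * e⁻¹ * B = (A * r) ^ 2 := by
    have : e⁻¹ = r * a 2 * r := by rw [h2, mul_assoc, hr, mul_one]
    rw [this, pow_two, mul_assoc A, mul_assoc (r * a 2), hB.eq, hA]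
    simp only [mul_assoc]
  rw [he, ← pow_mul] at h5
  have hs : ∀ n, (r * A) ^ n * r = r * (A * r) ^ n := by
    intro n
    induction n with
    | zero => simp
    | succ n ih => rw [pow_succ', mul_assoc, ih, pow_succ']; simp only [mul_assoc]
  rw [pow_succ, ← mul_assoc, hs, mul_assoc, ← h5, hr]
end
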